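/- Let M be the uncentered maximal operator on (ℝ^2, ‖·‖_∞) associated to ℓ∞ balls (axis-parallel squares), acting on Lipschitz functions with respect to the ℓ∞ norm. Then ‖M‖_{Op(1)} = (4/√3)·cos(5π/18) + √3·sec(5π/18) − (1/4)·sec²(5π/18) − 3. -/

import Mathlib

open MeasureTheory Set Filter Topology

/-- The closed ball of the norm-like function `N`, with center `c` and radius `R`. -/
def nball {d : ℕ} (N : (Fin d → ℝ) → ℝ) (c : Fin d → ℝ) (R : ℝ) : Set (Fin d → ℝ) :=
  {y | N (y - c) ≤ R}

/-- The uncentered Hardy–Littlewood maximal function associated to the norm `N`,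
with respect to `d`-dimensional Lebesgue measure. -/
noncomputable def maxFn {d : ℕ} (N : (Fin d → ℝ) → ℝ) (f : (Fin d → ℝ) → ℝ)
    (x : Fin d → ℝ) : ℝ :=
  sSup {a : ℝ | ∃ c : Fin d → ℝ, ∃ R : ℝ, 0 < R ∧ x ∈ nball N c R ∧
    a = ⨍ y in nball N c R, |f y|}

/-- The modulus of continuity of `g`, with distances measured using `N`. -/
noncomputable def modCont {d : ℕ} (N : (Fin d → ℝ) → ℝ) (g : (Fin d → ℝ) → ℝ) (δ : ℝ) : ℝ :=
  sSup {a : ℝ | ∃ x y : Fin d → ℝ, N (x - y) ≤ δ ∧ a = |g x - g y|}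

/-- `N` is a norm on `ℝ^d`. -/
structure IsNorm {d : ℕ} (N : (Fin d → ℝ) → ℝ) : Prop where
  eq_zero_iff : ∀ x, N x = 0 ↔ x = 0
  add_le : ∀ x y, N (x + y) ≤ N x + N y
  smul : ∀ (a : ℝ) (x), N (a • x) = |a| * N x

/-- `ω` is a modulus of continuity: continuous, nondecreasing, subadditive on `[0,∞)`,
vanishing at `0`, nonnegative, and not identically zero. -/
structure IsModulus (ω : ℝ → ℝ) : Prop where
  nonneg : ∀ t, 0 ≤ t → 0 ≤ ω t
  map_zero : ω 0 = 0
  mono : MonotoneOn ω (Ici 0)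
  subadd : ∀ a b, 0 ≤ a → 0 ≤ b → ω (a + b) ≤ ω a + ω b
  cont : ContinuousOn ω (Ici 0)
  nontrivial : ∃ t, 0 < t ∧ ω t ≠ 0

/-- The `Lip(ω)` seminorm of `f`: `sup_{t>0} ω(f,t)/ω(t)`. -/
noncomputable def lipNorm {d : ℕ} (N : (Fin d → ℝ) → ℝ) (ω : ℝ → ℝ)
    (f : (Fin d → ℝ) → ℝ) : ℝ :=
  sSup {a : ℝ | ∃ t : ℝ, 0 < t ∧ a = modCont N f t / ω t}

/-- The operator norm of the uncentered maximal operator on `Lip(ω)`. -/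
noncomputable def opNorm (d : ℕ) (N : (Fin d → ℝ) → ℝ) (ω : ℝ → ℝ) : ℝ :=
  sSup {a : ℝ | ∃ f : (Fin d → ℝ) → ℝ, lipNorm N ω f = 1 ∧ a = lipNorm N ω (maxFn N f)}

/-- The Hölder `α` seminorm of `f`, distances measured with `N`. -/
noncomputable def holderNorm {d : ℕ} (N : (Fin d → ℝ) → ℝ) (α : ℝ)
    (f : (Fin d → ℝ) → ℝ) : ℝ :=
  sSup {a : ℝ | ∃ x y : Fin d → ℝ, x ≠ y ∧ a = |f x - f y| / N (x - y) ^ α}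

/-- The operator norm of the uncentered maximal operator on the Hölder class `Lip_α`. -/
noncomputable def opNormHolder (d : ℕ) (N : (Fin d → ℝ) → ℝ) (α : ℝ) : ℝ :=
  sSup {a : ℝ | ∃ f : (Fin d → ℝ) → ℝ, holderNorm N α f = 1 ∧
    a = holderNorm N α (maxFn N f)}

/-- Averages over cubes are invariant under diagonal similarities. -/
lemma setAverage_closedBall_diag {ι : Type*} [Fintype ι] (g : (ι → ℝ) → ℝ) (b s z : ι → ℝ)
    {m r : ℝ} (hm : 0 < m) (hs : ∀ i, |s i| = m) (hr : 0 ≤ r) :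
    ⨍ y in Metric.closedBall (fun i => b i + s i * z i) (m * r), g y =
      ⨍ w in Metric.closedBall z r, g (fun i => b i + s i * w i) := by
  set ψ : (ι → ℝ) → ι → ℝ := fun w i => b i + s i * w i with hψ
  have hs0 : ∀ i, s i ≠ 0 := fun i h => by
    have := hs i
    rw [h, abs_zero] at this
    exact hm.ne this
  have himg : ψ '' Metric.closedBall z r = Metric.closedBall (ψ z) (m * r) := by
    ext y
    simp only [mem_image, Metric.mem_closedBall, dist_pi_le_iff hr,
      dist_pi_le_iff (mul_nonneg hm.le hr), Real.dist_eq]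
    constructor
    · rintro ⟨w, hw, rfl⟩ i
      have : ψ w i - ψ z i = s i * (w i - z i) := by simp only [hψ]; ring
      rw [this, abs_mul, hs]
      exact mul_le_mul_of_nonneg_left (hw i) hm.le
    · intro hy
      refine ⟨fun i => (y i - b i) / s i, fun i => ?_, ?_⟩
      · have h := hy i
        have : y i - ψ z i = s i * ((y i - b i) / s i - z i) := by
          simp only [hψ]; field_simp [hs0 i]; ring
        rw [this, abs_mul, hs] at h
        exact le_of_mul_le_mul_left h hm
      · funext i
        simp only [hψ]; field_simp [hs0 i]; ring
  have hinj : InjOn ψ (Metric.closedBall z r) := by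
    intro u _ v _ huv
    funext i
    have := congrFun huv i
    simp only [hψ] at this
    exact mul_left_cancel₀ (hs0 i) (add_left_cancel this)
  set L : (ι → ℝ) →L[ℝ] (ι → ℝ) := ContinuousLinearMap.pi fun i =>
    (s i • ContinuousLinearMap.id ℝ ℝ) ∘SL ContinuousLinearMap.proj i with hL
  have hderiv : ∀ x ∈ Metric.closedBall z r,
      HasFDerivWithinAt ψ L (Metric.closedBall z r) x := by
    intro x _
    have h : ψ = fun w => b + L w := by
      funext w i
      simp [hψ, hL]
    rw [h]
    exact (L.hasFDerivWithinAt).const_add b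
  have hdet : L.det ≠ 0 := by
    rw [hL, ContinuousLinearMap.det_pi]
    refine Finset.prod_ne_zero_iff.mpr fun i _ => ?_
    have : (s i • ContinuousLinearMap.id ℝ ℝ).det = s i := by
      simp [ContinuousLinearMap.det]
    rw [this]
    exact hs0 i
  have hcov : ∀ h : (ι → ℝ) → ℝ, ∫ y in Metric.closedBall (ψ z) (m * r), h y =
      |L.det| * ∫ w in Metric.closedBall z r, h (ψ w) := by
    intro h
    rw [← himg, integral_image_eq_integral_abs_det_fderiv_smul volume
      measurableSet_closedBall hderiv hinj]
    simp only [smul_eq_mul]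
    exact integral_const_mul _ _
  have hvol : volume.real (Metric.closedBall (ψ z) (m * r)) =
      |L.det| * volume.real (Metric.closedBall z r) := by
    simpa using hcov fun _ => 1
  change ⨍ y in Metric.closedBall (ψ z) (m * r), g y = _
  rw [setAverage_eq, setAverage_eq, hcov, hvol, smul_eq_mul, smul_eq_mul]
  rw [mul_inv, mul_mul_mul_comm, inv_mul_cancel₀ (abs_ne_zero.mpr hdet), one_mul]

/-- The tent function of height one at the origin. -/
noncomputable def tent (x : Fin 2 → ℝ) : ℝ := max (1 - ‖x‖) 0

lemma tent_nonneg (x : Fin 2 → ℝ) : 0 ≤ tent x := le_max_right _ _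

lemma tent_le_one (x : Fin 2 → ℝ) : tent x ≤ 1 :=
  max_le (by linarith [norm_nonneg x]) zero_le_one

lemma continuous_tent : Continuous tent := by
  unfold tent
  fun_prop

lemma abs_tent_sub_le (x y : Fin 2 → ℝ) : |tent x - tent y| ≤ ‖x - y‖ := by
  refine (abs_max_sub_max_le_abs _ _ _).trans ?_
  rw [sub_sub_sub_cancel_left, norm_sub_rev x y]
  exact abs_norm_sub_norm_le y x

lemma Continuous.integrableOn_closedBall {g : (Fin 2 → ℝ) → ℝ} (hg : Continuous g)
    (c : Fin 2 → ℝ) (R : ℝ) : IntegrableOn g (Metric.closedBall c R) :=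
  hg.continuousOn.integrableOn_compact (isCompact_closedBall c R)

lemma closedBall_eq_Icc_pi {ι : Type*} [Fintype ι] (c : ι → ℝ) {R : ℝ} (hR : 0 ≤ R) :
    Metric.closedBall c R = Icc (fun i => c i - R) fun i => c i + R := by
  rw [closedBall_pi _ hR, ← pi_univ_Icc]
  simp [Real.closedBall_eq_Icc]

lemma volume_real_closedBall_sq (c : Fin 2 → ℝ) {R : ℝ} (hR : 0 ≤ R) :
    volume.real (Metric.closedBall c R) = (2 * R) ^ 2 := by
  rw [closedBall_eq_Icc_pi c hR, measureReal_def, Real.volume_Icc_pi_toReal]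
  · simp; ring
  · intro i
    simp only
    linarith

lemma setIntegral_tent (c : Fin 2 → ℝ) {R : ℝ} (hR : 0 ≤ R) :
    ∫ y in Metric.closedBall c R, tent y =
      ∫ t in (0 : ℝ)..1, ∏ i, max (min (c i + R) t - max (c i - R) (-t)) 0 := by
  rw [Integrable.integral_eq_integral_Ioc_meas_le
      (continuous_tent.integrableOn_closedBall c R)
      (Eventually.of_forall tent_nonneg) (Eventually.of_forall tent_le_one),
    ← intervalIntegral.integral_of_le zero_le_one]
  have hsub := intervalIntegral.integral_comp_sub_left (a := 0) (b := 1)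
    (fun t => ∏ i, max (min (c i + R) t - max (c i - R) (-t)) 0) 1
  rw [sub_self, sub_zero] at hsub
  rw [← hsub]
  refine intervalIntegral.integral_congr_ae (Eventually.of_forall fun t ht => ?_)
  rw [uIoc_of_le zero_le_one] at ht
  have hset : {a | t ≤ tent a} = Metric.closedBall (0 : Fin 2 → ℝ) (1 - t) := by
    ext a
    simp only [mem_ofPred_eq, tent, le_max_iff, mem_closedBall_zero_iff]
    constructor
    · rintro (h | h)
      · linarith
      · linarith [ht.1]
    · intro h
      left
      linarith
  rw [hset, measureReal_def, Measure.restrict_apply measurableSet_closedBall,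
    closedBall_eq_Icc_pi _ (sub_nonneg.mpr ht.2), closedBall_eq_Icc_pi c hR, Icc_inter_Icc,
    Real.volume_Icc_pi, ENNReal.toReal_prod]
  refine Finset.prod_congr rfl fun i _ => ?_
  rw [ENNReal.toReal_ofReal']
  simp only [Pi.inf_apply, Pi.sup_apply, Pi.zero_apply, zero_add, zero_sub]
  rw [inf_comm, sup_comm (-(1 - t))]

/-- The integral of `tent` over `[-1, l - 1]²`. -/
noncomputable def cornerIntegral (l : ℝ) : ℝ :=
  ∫ t in (0 : ℝ)..1, (max (min (l - 1) t + t) 0) ^ 2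

lemma setIntegral_tent_le {c : Fin 2 → ℝ} {R : ℝ} (hR : 0 ≤ R)
    (hc : (-1 : Fin 2 → ℝ) ∈ Metric.closedBall c R) :
    ∫ y in Metric.closedBall c R, tent y ≤ cornerIntegral (2 * R) := by
  rw [setIntegral_tent c hR, cornerIntegral]
  refine intervalIntegral.integral_mono_on zero_le_one
    (Continuous.intervalIntegrable (by fun_prop) _ _)
    (Continuous.intervalIntegrable (by fun_prop) _ _) fun t ht => ?_
  rw [closedBall_eq_Icc_pi c hR] at hc
  have key : ∀ i, max (min (c i + R) t - max (c i - R) (-t)) 0 ≤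
      max (min (2 * R - 1) t + t) 0 := by
    intro i
    have h1 : c i - R ≤ -1 := hc.1 i
    refine max_le_max ?_ le_rfl
    have h2 : min (c i + R) t ≤ min (2 * R - 1) t := min_le_min (by linarith) le_rfl
    linarith [le_max_right (c i - R) (-t)]
  rw [Fin.prod_univ_two, sq]
  exact mul_le_mul (key 0) (key 1) (le_max_right _ _) (le_max_right _ _)

lemma setIntegral_tent_corner {R : ℝ} (hR : 0 ≤ R) :
    ∫ y in Metric.closedBall (fun _ => R - 1 : Fin 2 → ℝ) R, tent y =
      cornerIntegral (2 * R) := by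
  rw [setIntegral_tent _ hR, cornerIntegral]
  refine intervalIntegral.integral_congr fun t ht => ?_
  rw [uIcc_of_le zero_le_one] at ht
  have h1 : max (R - 1 - R) (-t) = -t := max_eq_right (by linarith [ht.2])
  simp only [Fin.prod_univ_two, sq, h1, sub_neg_eq_add]
  ring_nf

lemma integral_add_sq (a b e : ℝ) :
    ∫ t in a..b, (t + e) ^ 2 = ((b + e) ^ 3 - (a + e) ^ 3) / 3 := by
  rw [intervalIntegral.integral_comp_add_right (fun t => t ^ 2), integral_pow]
  norm_num

lemma integral_two_mul_sq (a b : ℝ) :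
    ∫ t in a..b, (2 * t) ^ 2 = 4 * (b ^ 3 - a ^ 3) / 3 := by
  simp only [mul_pow]
  rw [intervalIntegral.integral_const_mul, integral_pow]
  norm_num
  ring

lemma cornerIntegral_of_le_one {l : ℝ} (h0 : 0 ≤ l) (h1 : l ≤ 1) :
    cornerIntegral l = l ^ 3 / 3 := by
  have hI : ∀ a b : ℝ, IntervalIntegrable (fun t => (max (min (l - 1) t + t) 0) ^ 2) volume a b :=
    fun a b => Continuous.intervalIntegrable (by fun_prop) _ _
  rw [cornerIntegral, ← intervalIntegral.integral_add_adjacent_intervals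
    (hI 0 (1 - l)) (hI (1 - l) 1)]
  have e1 : ∫ t in (0 : ℝ)..(1 - l), (max (min (l - 1) t + t) 0) ^ 2 =
      ∫ _ in (0 : ℝ)..(1 - l), (0 : ℝ) := by
    refine intervalIntegral.integral_congr fun t ht => ?_
    rw [uIcc_of_le (by linarith)] at ht
    rw [max_eq_right (by linarith [min_le_left (l - 1) t, ht.2])]
    norm_num
  have e2 : ∫ t in (1 - l)..1, (max (min (l - 1) t + t) 0) ^ 2 =
      ∫ t in (1 - l)..1, (t + (l - 1)) ^ 2 := by
    refine intervalIntegral.integral_congr fun t ht => ?_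
    rw [uIcc_of_le (by linarith)] at ht
    rw [min_eq_left (by linarith [ht.1]), max_eq_left (by linarith [ht.1]), add_comm]
  rw [e1, e2, integral_add_sq, intervalIntegral.integral_zero]
  ring

lemma cornerIntegral_of_mem_Icc {l : ℝ} (h1 : 1 ≤ l) (h2 : l ≤ 2) :
    cornerIntegral l = 4 * (l - 1) ^ 3 / 3 + (l ^ 3 - (2 * (l - 1)) ^ 3) / 3 := by
  have hI : ∀ a b : ℝ, IntervalIntegrable (fun t => (max (min (l - 1) t + t) 0) ^ 2) volume a b :=
    fun a b => Continuous.intervalIntegrable (by fun_prop) _ _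
  rw [cornerIntegral, ← intervalIntegral.integral_add_adjacent_intervals
    (hI 0 (l - 1)) (hI (l - 1) 1)]
  have e1 : ∫ t in (0 : ℝ)..(l - 1), (max (min (l - 1) t + t) 0) ^ 2 =
      ∫ t in (0 : ℝ)..(l - 1), (2 * t) ^ 2 := by
    refine intervalIntegral.integral_congr fun t ht => ?_
    rw [uIcc_of_le (by linarith)] at ht
    rw [min_eq_right ht.2, max_eq_left (by linarith [ht.1]), two_mul]
  have e2 : ∫ t in (l - 1)..1, (max (min (l - 1) t + t) 0) ^ 2 =
      ∫ t in (l - 1)..1, (t + (l - 1)) ^ 2 := by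
    refine intervalIntegral.integral_congr fun t ht => ?_
    rw [uIcc_of_le (by linarith)] at ht
    rw [min_eq_left ht.1, max_eq_left (by linarith [ht.1]), add_comm]
  rw [e1, e2, integral_add_sq, integral_two_mul_sq]
  ring

lemma cornerIntegral_of_two_le {l : ℝ} (h2 : 2 ≤ l) : cornerIntegral l = 4 / 3 := by
  have e1 : cornerIntegral l = ∫ t in (0 : ℝ)..1, (2 * t) ^ 2 := by
    refine intervalIntegral.integral_congr fun t ht => ?_
    rw [uIcc_of_le zero_le_one] at ht
    rw [min_eq_right (by linarith [ht.2]), max_eq_left (by linarith [ht.1]), two_mul]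
  rw [e1, integral_two_mul_sq]
  norm_num

/-- The minimum over `l` of the mean of `‖·‖` over `[-1, l - 1]²`, in terms of the
minimizer `k`. -/
noncomputable def lipConst (k : ℝ) : ℝ := k + 4 / k - 4 / (3 * k ^ 2) - 3

lemma cornerIntegral_eq_lipConst {k : ℝ} (h1 : 1 ≤ k) (h2 : k ≤ 2) :
    cornerIntegral k = (1 - lipConst k) * k ^ 2 := by
  rw [cornerIntegral_of_mem_Icc h1 h2, lipConst]
  have : k ≠ 0 := by positivity
  field_simp
  ring

/-- The critical point equation, together with `4 ≤ 3 k²`, makes `k` a global minimizer. -/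
lemma cornerIntegral_le {k l : ℝ} (hk0 : 0 < k) (hk : 4 ≤ 3 * k ^ 2)
    (hcrit : 3 * k ^ 3 - 12 * k + 8 = 0) (hl : 0 ≤ l) :
    cornerIntegral l ≤ (1 - lipConst k) * l ^ 2 := by
  have hr : 4 / (3 * k ^ 2) ≤ 1 := by
    rw [div_le_one (by positivity)]; exact hk
  have hcub : ∀ l : ℝ, l ^ 3 - (3 + lipConst k) * l ^ 2 + 4 * l - 4 / 3 =
      (l - k) ^ 2 * (l - 4 / (3 * k ^ 2)) := by
    intro l
    unfold lipConst
    field_simp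
    linear_combination (l ^ 2 - l * k) * hcrit
  have hC : lipConst k ≤ 2 / 3 := by
    have h := hcub 1
    have := mul_nonneg (sq_nonneg (1 - k)) (sub_nonneg.mpr hr)
    linarith
  rcases le_total l 1 with h1 | h1
  · rw [cornerIntegral_of_le_one hl h1]
    nlinarith [mul_nonneg (sq_nonneg l) (sub_nonneg.mpr h1),
      mul_nonneg (sq_nonneg l) (sub_nonneg.mpr hC)]
  rcases le_total l 2 with h2 | h2
  · rw [cornerIntegral_of_mem_Icc h1 h2]
    have h := hcub l
    have := mul_nonneg (sq_nonneg (l - k)) (sub_nonneg.mpr (hr.trans h1))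
    nlinarith
  · rw [cornerIntegral_of_two_le h2]
    nlinarith

lemma setIntegral_norm_corner {k : ℝ} (h1 : 1 ≤ k) (h2 : k ≤ 2) :
    ∫ w in Metric.closedBall (fun _ => k / 2 - 1 : Fin 2 → ℝ) (k / 2), ‖w‖ =
      lipConst k * k ^ 2 := by
  have h : ∫ w in Metric.closedBall (fun _ => k / 2 - 1 : Fin 2 → ℝ) (k / 2), ‖w‖ =
      ∫ w in Metric.closedBall (fun _ => k / 2 - 1 : Fin 2 → ℝ) (k / 2), (1 - tent w) := by
    refine setIntegral_congr_fun measurableSet_closedBall fun w hw => ?_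
    rw [closedBall_eq_Icc_pi _ (by linarith)] at hw
    have hw1 : ‖w‖ ≤ 1 := by
      refine (pi_norm_le_iff_of_nonneg zero_le_one).mpr fun i => ?_
      have hl : k / 2 - 1 - k / 2 ≤ w i := hw.1 i
      have hu : w i ≤ k / 2 - 1 + k / 2 := hw.2 i
      rw [Real.norm_eq_abs, abs_le]
      constructor <;> linarith
    rw [tent, max_eq_left (by linarith)]
    ring
  rw [h, integral_sub (continuous_const.integrableOn_closedBall _ _)
    (continuous_tent.integrableOn_closedBall _ _), setIntegral_tent_corner (by linarith),
    mul_div_cancel₀ k two_ne_zero, cornerIntegral_eq_lipConst h1 h2, setIntegral_const,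
    volume_real_closedBall_sq _ (by linarith), smul_eq_mul]
  ring

/-- For every cube containing `x` there is a larger cube containing `y` over which the mean of a
nonexpansive function drops by at most `lipConst k * ‖x - y‖`. -/
lemma exists_setAverage_le {g : (Fin 2 → ℝ) → ℝ} (hg : ∀ x y, |g x - g y| ≤ ‖x - y‖)
    {k : ℝ} (h1 : 1 ≤ k) (h2 : k ≤ 2) {x y c : Fin 2 → ℝ} {R : ℝ} (hR : 0 < R)
    (hx : x ∈ Metric.closedBall c R) :
    ∃ c' : Fin 2 → ℝ, ∃ R' : ℝ, 0 < R' ∧ y ∈ Metric.closedBall c' R' ∧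
      ⨍ u in Metric.closedBall c R, g u ≤
        (⨍ u in Metric.closedBall c' R', g u) + lipConst k * ‖x - y‖ := by
  have hgc : Continuous g := (LipschitzWith.of_dist_le_mul (K := 1) fun u v => by
    simpa [Real.dist_eq, dist_eq_norm] using hg u v).continuous
  have hk0 : 0 < k := by linarith
  set δ := ‖x - y‖ with hδ
  have hδ0 : 0 ≤ δ := norm_nonneg _
  set s : Fin 2 → ℝ := fun i => if y i ≤ c i then 1 else -1 with hs
  have hs1 : ∀ i, |s i| = 1 := fun i => by
    simp only [hs]
    split_ifs <;> simp
  set z : Fin 2 → ℝ := fun _ => k / 2 - 1 with hz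
  set b : Fin 2 → ℝ := fun i => c i - s i * (2 * R / k) * z i with hb
  have hm : 0 < 2 * R / k := by positivity
  have hm' : 0 < 2 * R / k + δ := by positivity
  have hc : c = fun i => b i + s i * (2 * R / k) * z i := by
    funext i
    simp only [hb]
    ring
  have hRm : R = 2 * R / k * (k / 2) := by field_simp
  have hxy : ∀ i, |x i - y i| ≤ δ := fun i => by
    simpa [hδ] using norm_le_pi_norm (x - y) i
  refine ⟨fun i => b i + s i * (2 * R / k + δ) * z i, (2 * R / k + δ) * (k / 2),
    by positivity, ?_, ?_⟩
  · rw [Metric.mem_closedBall, dist_pi_le_iff (by positivity)]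
    intro i
    rw [Metric.mem_closedBall, dist_pi_le_iff hR.le] at hx
    have hxi := abs_le.mp (Real.dist_eq _ _ ▸ hx i)
    have hyi := abs_le.mp (hxy i)
    have e1 : b i + s i * (2 * R / k + δ) * z i = c i + s i * (δ * k / 2 - δ) := by
      simp only [hb, hz]
      ring
    have e2 : (2 * R / k + δ) * (k / 2) = R + δ * k / 2 := by
      field_simp
    have hk1 : δ ≤ δ * k := le_mul_of_one_le_right hδ0 h1
    have hk2 : δ * k ≤ δ * 2 := mul_le_mul_of_nonneg_left h2 hδ0
    rw [e1, e2, Real.dist_eq, abs_le]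
    simp only [hs]
    split_ifs with h
    · constructor <;> linarith [hxi.1, hxi.2, hyi.1, hyi.2]
    · constructor <;> linarith [hxi.1, hxi.2, hyi.1, hyi.2]
  · have A1 := setAverage_closedBall_diag g b (fun i => s i * (2 * R / k)) z hm
      (fun i => by rw [abs_mul, hs1, one_mul, abs_of_pos hm]) (by positivity : 0 ≤ k / 2)
    have A2 := setAverage_closedBall_diag g b (fun i => s i * (2 * R / k + δ)) z hm'
      (fun i => by rw [abs_mul, hs1, one_mul, abs_of_pos hm']) (by positivity : 0 ≤ k / 2)
    rw [← hRm, ← hc] at A1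
    rw [A1, A2, setAverage_eq, setAverage_eq, volume_real_closedBall_sq _ (by positivity),
      mul_div_cancel₀ k two_ne_zero, smul_eq_mul, smul_eq_mul]
    have hI : ∀ t : ℝ, IntegrableOn (fun w : Fin 2 → ℝ => g fun i => b i + s i * t * w i)
        (Metric.closedBall z (k / 2)) := fun t =>
      Continuous.integrableOn_closedBall (hgc.comp (by fun_prop)) _ _
    have hN : IntegrableOn (fun w : Fin 2 → ℝ => δ * ‖w‖) (Metric.closedBall z (k / 2)) :=
      Continuous.integrableOn_closedBall (by fun_prop) _ _
    have hle : ∫ w in Metric.closedBall z (k / 2), g (fun i => b i + s i * (2 * R / k) * w i) ≤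
        (∫ w in Metric.closedBall z (k / 2), g fun i => b i + s i * (2 * R / k + δ) * w i) +
          δ * (lipConst k * k ^ 2) := by
      rw [← setIntegral_norm_corner h1 h2, ← integral_const_mul, ← integral_add (hI _) hN]
      refine integral_mono (hI _) ((hI _).add hN) fun w => ?_
      have h := (abs_le.mp (hg (fun i => b i + s i * (2 * R / k) * w i)
        (fun i => b i + s i * (2 * R / k + δ) * w i))).2
      have hn : ‖(fun i => b i + s i * (2 * R / k) * w i) -
          fun i => b i + s i * (2 * R / k + δ) * w i‖ ≤ δ * ‖w‖ := by
        refine (pi_norm_le_iff_of_nonneg (by positivity)).mpr fun i => ?_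
        have e : ((fun i => b i + s i * (2 * R / k) * w i) -
          fun i => b i + s i * (2 * R / k + δ) * w i) i = -(s i * (δ * w i)) := by
          simp only [Pi.sub_apply]
          ring
        rw [e, Real.norm_eq_abs, abs_neg, abs_mul, hs1, one_mul, abs_mul, abs_of_nonneg hδ0]
        exact mul_le_mul_of_nonneg_left (norm_le_pi_norm w i) hδ0
      simp only
      linarith
    have hk2 : 0 < k ^ 2 := by positivity
    rw [inv_mul_le_iff₀ hk2, mul_add, mul_inv_cancel_left₀ hk2.ne']
    linarith

lemma nball_norm {d : ℕ} (c : Fin d → ℝ) (R : ℝ) :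
    nball (fun x => ‖x‖) c R = Metric.closedBall c R := by
  ext y
  simp [nball, dist_eq_norm]

lemma maxFn_le_add {f : (Fin 2 → ℝ) → ℝ} (hf : ∀ x y, |f x - f y| ≤ ‖x - y‖)
    {k : ℝ} (h1 : 1 ≤ k) (h2 : k ≤ 2) (hC : 0 ≤ lipConst k) (x y : Fin 2 → ℝ) :
    maxFn (fun x => ‖x‖) f x ≤ maxFn (fun x => ‖x‖) f y + lipConst k * ‖x - y‖ := by
  have hg : ∀ x y, |(|f x|) - (|f y|)| ≤ ‖x - y‖ := fun x y =>
    (abs_abs_sub_abs_le_abs_sub _ _).trans (hf x y)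
  simp only [maxFn, nball_norm]
  set A : (Fin 2 → ℝ) → Set ℝ := fun x => {a : ℝ | ∃ c : Fin 2 → ℝ, ∃ R : ℝ, 0 < R ∧
    x ∈ Metric.closedBall c R ∧ a = ⨍ y in Metric.closedBall c R, |f y|} with hA
  have hex : ∀ x y, ∀ a ∈ A x, ∃ a' ∈ A y, a ≤ a' + lipConst k * ‖x - y‖ := by
    rintro x y a ⟨c, R, hR, hx, rfl⟩
    obtain ⟨c', R', hR', hy, hle⟩ := exists_setAverage_le (y := y) hg h1 h2 hR hx
    exact ⟨_, ⟨c', R', hR', hy, rfl⟩, hle⟩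
  have hne : ∀ x, (A x).Nonempty := fun x =>
    ⟨_, x, 1, one_pos, Metric.mem_closedBall_self zero_le_one, rfl⟩
  have hbdd : ∀ x y, BddAbove (A y) → BddAbove (A x) := by
    rintro x y ⟨B, hB⟩
    refine ⟨B + lipConst k * ‖x - y‖, fun a ha => ?_⟩
    obtain ⟨a', ha', hle⟩ := hex x y a ha
    exact hle.trans (add_le_add_left (hB ha') _)
  change sSup (A x) ≤ sSup (A y) + _
  by_cases hy : BddAbove (A y)
  · refine csSup_le (hne x) fun a ha => ?_
    obtain ⟨a', ha', hle⟩ := hex x y a ha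
    exact hle.trans (add_le_add_left (le_csSup hy ha') _)
  · rw [Real.sSup_of_not_bddAbove hy,
      Real.sSup_of_not_bddAbove fun hx => hy (hbdd y x hx), zero_add]
    positivity

lemma abs_maxFn_sub_le {f : (Fin 2 → ℝ) → ℝ} (hf : ∀ x y, |f x - f y| ≤ ‖x - y‖)
    {k : ℝ} (h1 : 1 ≤ k) (h2 : k ≤ 2) (hC : 0 ≤ lipConst k) (x y : Fin 2 → ℝ) :
    |maxFn (fun x => ‖x‖) f x - maxFn (fun x => ‖x‖) f y| ≤ lipConst k * ‖x - y‖ := by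
  have h := maxFn_le_add hf h1 h2 hC x y
  have h' := maxFn_le_add hf h1 h2 hC y x
  rw [norm_sub_rev] at h'
  exact abs_sub_le_iff.mpr ⟨by linarith, by linarith⟩

lemma one_le_maxFn_tent_zero : 1 ≤ maxFn (fun x => ‖x‖) tent 0 := by
  simp only [maxFn, nball_norm, abs_of_nonneg (tent_nonneg _)]
  have havg : ∀ (c : Fin 2 → ℝ) {R : ℝ}, 0 < R →
      ⨍ y in Metric.closedBall c R, tent y ≤ 1 := by
    intro c R hR
    rw [setAverage_eq, volume_real_closedBall_sq _ hR.le, smul_eq_mul,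
      inv_mul_le_iff₀ (by positivity), mul_one, ← volume_real_closedBall_sq c hR.le]
    have h := integral_mono (continuous_tent.integrableOn_closedBall c R)
      ((continuous_const (y := (1 : ℝ))).integrableOn_closedBall c R) tent_le_one
    simpa using h
  refine le_of_forall_pos_le_add fun ε hε => ?_
  have hle : 1 - ε ≤ ⨍ y in Metric.closedBall (0 : Fin 2 → ℝ) ε, tent y := by
    rw [setAverage_eq, volume_real_closedBall_sq _ hε.le, smul_eq_mul,
      le_inv_mul_iff₀ (by positivity), ← volume_real_closedBall_sq (0 : Fin 2 → ℝ) hε.le]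
    have h := setIntegral_mono_on
      ((continuous_const (y := 1 - ε)).integrableOn_closedBall (0 : Fin 2 → ℝ) ε)
      (continuous_tent.integrableOn_closedBall 0 ε) measurableSet_closedBall fun w hw =>
        (sub_le_sub_left (mem_closedBall_zero_iff.mp hw) 1).trans (le_max_left _ 0)
    simpa using h
  have hsup := le_csSup (s := {a : ℝ | ∃ c : Fin 2 → ℝ, ∃ R : ℝ, 0 < R ∧
      0 ∈ Metric.closedBall c R ∧ a = ⨍ y in Metric.closedBall c R, tent y})
    ⟨1, by rintro a ⟨c, R, hR, -, rfl⟩; exact havg c hR⟩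
    ⟨0, ε, hε, Metric.mem_closedBall_self hε.le, rfl⟩
  linarith

lemma maxFn_tent_neg_one_le {k : ℝ} (hk0 : 0 < k) (hk : 4 ≤ 3 * k ^ 2)
    (hcrit : 3 * k ^ 3 - 12 * k + 8 = 0) :
    maxFn (fun x => ‖x‖) tent (-1) ≤ 1 - lipConst k := by
  simp only [maxFn, nball_norm, abs_of_nonneg (tent_nonneg _)]
  refine csSup_le ⟨_, -1, 1, one_pos, Metric.mem_closedBall_self zero_le_one, rfl⟩ ?_
  rintro a ⟨c, R, hR, hc, rfl⟩
  rw [setAverage_eq, volume_real_closedBall_sq _ hR.le, smul_eq_mul,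
    inv_mul_le_iff₀ (by positivity), mul_comm]
  exact (setIntegral_tent_le hR.le hc).trans
    (cornerIntegral_le hk0 hk hcrit (by positivity))

lemma mem_upperBounds_holder {f : (Fin 2 → ℝ) → ℝ} {C : ℝ}
    (hf : ∀ x y, |f x - f y| ≤ C * ‖x - y‖) :
    C ∈ upperBounds {a : ℝ | ∃ x y : Fin 2 → ℝ, x ≠ y ∧
      a = |f x - f y| / ‖x - y‖ ^ (1 : ℝ)} := by
  rintro a ⟨x, y, hxy, rfl⟩
  rw [Real.rpow_one, div_le_iff₀ (norm_pos_iff.mpr (sub_ne_zero.mpr hxy))]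
  exact hf x y

lemma abs_sub_le_of_holderNorm_eq_one {f : (Fin 2 → ℝ) → ℝ}
    (hf : holderNorm (fun x => ‖x‖) 1 f = 1) (x y : Fin 2 → ℝ) : |f x - f y| ≤ ‖x - y‖ := by
  rcases eq_or_ne x y with rfl | hxy
  · simp
  have hb : BddAbove {a : ℝ | ∃ x y : Fin 2 → ℝ, x ≠ y ∧
      a = |f x - f y| / ‖x - y‖ ^ (1 : ℝ)} := by
    by_contra h
    rw [holderNorm, Real.sSup_of_not_bddAbove h] at hf
    exact zero_ne_one hf
  have h := le_csSup hb ⟨x, y, hxy, rfl⟩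
  change _ ≤ holderNorm (fun x => ‖x‖) 1 f at h
  rwa [hf, Real.rpow_one, div_le_one (norm_pos_iff.mpr (sub_ne_zero.mpr hxy))] at h

lemma le_holderNorm {f : (Fin 2 → ℝ) → ℝ} {C : ℝ}
    (hf : ∀ x y, |f x - f y| ≤ C * ‖x - y‖) :
    f 0 - f (-1) ≤ holderNorm (fun x => ‖x‖) 1 f := by
  refine le_trans ?_ (le_csSup ⟨C, mem_upperBounds_holder hf⟩
    ⟨0, -1, by simp [eq_comm], rfl⟩)
  simpa using le_abs_self (f 0 - f (-1))

lemma holderNorm_tent : holderNorm (fun x => ‖x‖) 1 tent = 1 := by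
  have h : ∀ x y, |tent x - tent y| ≤ 1 * ‖x - y‖ := by
    simpa using abs_tent_sub_le
  refine le_antisymm (csSup_le ⟨_, 0, -1, by simp [eq_comm], rfl⟩
    (mem_upperBounds_holder h)) ?_
  simpa [tent] using le_holderNorm h

lemma opNormHolder_eq_lipConst {k : ℝ} (hk0 : 0 < k) (hk2 : k ≤ 2) (hk : 4 ≤ 3 * k ^ 2)
    (hcrit : 3 * k ^ 3 - 12 * k + 8 = 0) :
    opNormHolder 2 (fun x => ‖x‖) 1 = lipConst k := by
  have hk1 : 1 ≤ k := by nlinarith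
  have hC : 0 ≤ lipConst k := by
    refine nonneg_of_mul_nonneg_left ?_ (by positivity : 0 < k ^ 2)
    rw [← setIntegral_norm_corner hk1 hk2]
    positivity
  refine IsGreatest.csSup_eq ⟨⟨tent, holderNorm_tent, ?_⟩, ?_⟩
  · have h := abs_maxFn_sub_le abs_tent_sub_le hk1 hk2 hC
    refine le_antisymm ?_ (csSup_le ⟨_, 0, -1, by simp [eq_comm], rfl⟩
      (mem_upperBounds_holder h))
    refine le_trans ?_ (le_holderNorm h)
    linarith [one_le_maxFn_tent_zero, maxFn_tent_neg_one_le hk0 hk hcrit]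
  · rintro a ⟨f, hf, rfl⟩
    exact csSup_le ⟨_, 0, -1, by simp [eq_comm], rfl⟩
      (mem_upperBounds_holder (abs_maxFn_sub_le
        (abs_sub_le_of_holderNorm_eq_one hf) hk1 hk2 hC))

/-- On Lipschitz functions of `(ℝ^2, ‖·‖_∞)`, the operator norm of the uncentered maximal
operator associated to axis-parallel squares is
`(4/√3)cos(5π/18) + √3 sec(5π/18) − (1/4)sec²(5π/18) − 3`. -/
theorem stmt12 :
    opNormHolder 2 (fun x => ‖x‖) 1 =
      4 / Real.sqrt 3 * Real.cos (5 * Real.pi / 18) +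
        Real.sqrt 3 * (Real.cos (5 * Real.pi / 18))⁻¹ -
        (1 / 4) * ((Real.cos (5 * Real.pi / 18))⁻¹) ^ 2 - 3 := by
  have hπ := Real.pi_pos
  have hlo : 1 / 2 ≤ Real.cos (5 * Real.pi / 18) := by
    rw [← Real.cos_pi_div_three]
    exact Real.cos_le_cos_of_nonneg_of_le_pi (by positivity) (by linarith) (by linarith)
  have hhi : Real.cos (5 * Real.pi / 18) ≤ Real.sqrt 3 / 2 := by
    rw [← Real.cos_pi_div_six]
    exact Real.cos_le_cos_of_nonneg_of_le_pi (by positivity) (by linarith) (by linarith)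
  have htriple : 4 * Real.cos (5 * Real.pi / 18) ^ 3 - 3 * Real.cos (5 * Real.pi / 18) =
      -(Real.sqrt 3 / 2) := by
    rw [← Real.cos_three_mul, ← Real.cos_pi_div_six, ← Real.cos_pi_sub]
    congr 1
    ring
  set c := Real.cos (5 * Real.pi / 18)
  have hc : 0 < c := by linarith
  have h3 : 0 < Real.sqrt 3 := by positivity
  have hsq : Real.sqrt 3 ^ 2 = 3 := Real.sq_sqrt (by norm_num)
  rw [opNormHolder_eq_lipConst (k := 4 / Real.sqrt 3 * c) (by positivity)]
  · rw [lipConst, mul_pow, div_pow, hsq]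
    field_simp
  · rw [div_mul_eq_mul_div, div_le_iff₀ h3]
    linarith
  · rw [mul_pow, div_pow, hsq]
    nlinarith
  · rw [mul_pow, div_pow]
    have h33 : Real.sqrt 3 ^ 3 = 3 * Real.sqrt 3 := by rw [pow_succ, hsq]
    rw [h33]
    field_simp
    linear_combination 16 * htriple
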